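/- arXiv:1903.10133 — 2 statements merged into one kernel-verified Lean document; each statement's English description precedes it below -/
import Mathlib

section
/- Let H be a finite simple graph with an FII-partition F ⊔ Iα ⊔ Iβ. Suppose v*, w1, w2, a1, a2, b1, b2, c1, c2, d1, d2 are eleven distinct vertices of H such that: v* is adjacent to w1 and w1 is adjacent to w2; w1 is adjacent to each of a1, a2, b1, b2 with a1 adjacent to a2 and b1 adjacent to b2; w2 is adjacent to each of c1, c2, d1, d2 with c1 adjacent to c2 and d1 adjacent to d2; and each of a1, a2, b1, b2, c1, c2, d1, d2 has degree exactly 2 in H (so w1 and w2 each lie on two pendent triangles). Then v* ∈ F. -/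
open scoped Classical

/-- `S` is a *2-independent set* of `G`: any two distinct vertices of `S` are at
distance at least 3 in `G`, i.e. they are non-adjacent and have no common neighbor. -/
def TwoIndepSet {W : Type*} (G : SimpleGraph W) (S : Set W) : Prop :=
  ∀ u ∈ S, ∀ v ∈ S, u ≠ v → ¬G.Adj u v ∧ ∀ w, ¬(G.Adj u w ∧ G.Adj w v)

/-- `F ⊔ A ⊔ B` is an *FII-partition* of `G`: the three sets partition the vertex set,
the subgraph induced on `F` is a forest (acyclic), and `A`, `B` are 2-independent sets. -/
def IsFIIPartition {W : Type*} (G : SimpleGraph W) (F A B : Set W) : Prop :=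
  (∀ v, v ∈ F ∨ v ∈ A ∨ v ∈ B) ∧
    Disjoint F A ∧ Disjoint F B ∧ Disjoint A B ∧
    (G.induce F).IsAcyclic ∧ TwoIndepSet G A ∧ TwoIndepSet G B

/-- `G` admits some FII-partition. -/
def HasFIIPartition {W : Type*} (G : SimpleGraph W) : Prop :=
  ∃ F A B, IsFIIPartition G F A B

/-- An acyclic induced subgraph contains no triangle. -/
theorem not_isAcyclic_induce_of_triangle {W : Type*} {G : SimpleGraph W} {F : Set W} {x y z : W}
    (hx : x ∈ F) (hy : y ∈ F) (hz : z ∈ F) (hxy : G.Adj x y) (hyz : G.Adj y z)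
    (hxz : G.Adj x z) : ¬(G.induce F).IsAcyclic := by
  intro h
  have exy : (G.induce F).Adj ⟨x, hx⟩ ⟨y, hy⟩ := hxy
  have eyz : (G.induce F).Adj ⟨y, hy⟩ ⟨z, hz⟩ := hyz
  have ezx : (G.induce F).Adj ⟨z, hz⟩ ⟨x, hx⟩ := hxz.symm
  refine h (.cons exy (.cons eyz (.cons ezx .nil))) ?_
  simp [SimpleGraph.Walk.cons_isCycle_iff, SimpleGraph.Walk.cons_isPath_iff, hxy.ne, hxy.ne',
    hyz.ne, hxz.ne, hxz.ne']

/-- In an FII-partition, a triangle with a vertex in `F` has another vertex outside `F`. -/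
theorem IsFIIPartition.exists_mem_of_triangle {W : Type*} {G : SimpleGraph W} {F A B : Set W}
    (h : IsFIIPartition G F A B) {y p q : W} (hy : y ∈ F)
    (hp : G.Adj y p) (hq : G.Adj y q) (hpq : G.Adj p q) :
    ∃ r, (r = p ∨ r = q) ∧ G.Adj y r ∧ (r ∈ A ∨ r ∈ B) := by
  rcases h.1 p with hpF | hpI
  · rcases h.1 q with hqF | hqI
    · exact absurd h.2.2.2.2.1 (not_isAcyclic_induce_of_triangle hy hpF hqF hp hpq hq)
    · exact ⟨q, .inr rfl, hq, hqI⟩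
  · exact ⟨p, .inl rfl, hp, hpI⟩

/-- A 2-independent set contains at most one neighbor of any vertex. -/
theorem TwoIndepSet.eq_of_adj {W : Type*} {G : SimpleGraph W} {S : Set W}
    (h : TwoIndepSet G S) {y u v : W} (hu : u ∈ S) (hv : v ∈ S)
    (hyu : G.Adj y u) (hyv : G.Adj y v) : u = v := by
  by_contra hne
  exact (h u hu v hv hne).2 y ⟨hyu.symm, hyv⟩

/-- In an FII-partition, if `y ∈ F` lies on two triangles sharing only `y`, then every other
neighbor of `y` is in `F`. -/
theorem IsFIIPartition.mem_of_adj_of_two_triangles {W : Type*} {G : SimpleGraph W}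
    {F A B : Set W} (h : IsFIIPartition G F A B) {x y p q r s : W} (hy : y ∈ F)
    (hyx : G.Adj y x) (hp : G.Adj y p) (hq : G.Adj y q) (hpq : G.Adj p q)
    (hr : G.Adj y r) (hs : G.Adj y s) (hrs : G.Adj r s)
    (hxp : x ≠ p) (hxq : x ≠ q) (hxr : x ≠ r) (hxs : x ≠ s)
    (hpr : p ≠ r) (hps : p ≠ s) (hqr : q ≠ r) (hqs : q ≠ s) : x ∈ F := by
  obtain ⟨t, ht, hyt, htI⟩ := h.exists_mem_of_triangle hy hp hq hpq
  obtain ⟨u, hu, hyu, huI⟩ := h.exists_mem_of_triangle hy hr hs hrs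
  have hxt : x ≠ t := by grind
  have hxu : x ≠ u := by grind
  have htu : t ≠ u := by grind
  obtain ⟨hcover, -, -, -, -, hA, hB⟩ := h
  rcases hcover x with hxF | hxA | hxB
  · exact hxF
  · rcases htI with htA | htB
    · exact absurd (hA.eq_of_adj hxA htA hyx hyt) hxt
    · rcases huI with huA | huB
      · exact absurd (hA.eq_of_adj hxA huA hyx hyu) hxu
      · exact absurd (hB.eq_of_adj htB huB hyt hyu) htu
  · rcases htI with htA | htB
    · rcases huI with huA | huB
      · exact absurd (hA.eq_of_adj htA huA hyt hyu) htu
      · exact absurd (hB.eq_of_adj hxB huB hyx hyu) hxu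
    · exact absurd (hB.eq_of_adj hxB htB hyx hyt) hxt

/-- Lemma 1.5 (ii): in a graph with an FII-partition `F ⊔ A ⊔ B`, if `v*` is adjacent to
`w1`, `w1` is adjacent to `w2`, and each of `w1`, `w2` carries two pendent triangles,
then `v* ∈ F`. -/
theorem mem_F_of_J2 {V : Type*} [Fintype V] (H : SimpleGraph V)
    (F A B : Set V) (hFII : IsFIIPartition H F A B)
    (vstar w1 w2 a1 a2 b1 b2 c1 c2 d1 d2 : V)
    (hdist : List.Pairwise (· ≠ ·) [vstar, w1, w2, a1, a2, b1, b2, c1, c2, d1, d2])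
    (hvw1 : H.Adj vstar w1) (hw1w2 : H.Adj w1 w2)
    (hw1a1 : H.Adj w1 a1) (hw1a2 : H.Adj w1 a2) (ha : H.Adj a1 a2)
    (hw1b1 : H.Adj w1 b1) (hw1b2 : H.Adj w1 b2) (hb : H.Adj b1 b2)
    (hw2c1 : H.Adj w2 c1) (hw2c2 : H.Adj w2 c2) (hc : H.Adj c1 c2)
    (hw2d1 : H.Adj w2 d1) (hw2d2 : H.Adj w2 d2) (hd : H.Adj d1 d2)
    (hda1 : H.degree a1 = 2) (hda2 : H.degree a2 = 2)
    (hdb1 : H.degree b1 = 2) (hdb2 : H.degree b2 = 2)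
    (hdc1 : H.degree c1 = 2) (hdc2 : H.degree c2 = 2)
    (hdd1 : H.degree d1 = 2) (hdd2 : H.degree d2 = 2) :
    vstar ∈ F := by
  simp only [List.pairwise_cons, List.mem_cons, List.not_mem_nil, or_false, forall_eq_or_imp,
    forall_eq, ne_eq] at hdist
  have hw1F : w1 ∈ F → vstar ∈ F := fun hw1 =>
    hFII.mem_of_adj_of_two_triangles hw1 hvw1.symm hw1a1 hw1a2 ha hw1b1 hw1b2 hb
      (by simp [hdist]) (by simp [hdist]) (by simp [hdist]) (by simp [hdist]) (by simp [hdist]) (by simp [hdist]) (by simp [hdist]) (by simp [hdist])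
  have hw2F : w2 ∈ F → w1 ∈ F := fun hw2 =>
    hFII.mem_of_adj_of_two_triangles hw2 hw1w2.symm hw2c1 hw2c2 hc hw2d1 hw2d2 hd
      (by simp [hdist]) (by simp [hdist]) (by simp [hdist]) (by simp [hdist]) (by simp [hdist]) (by simp [hdist]) (by simp [hdist]) (by simp [hdist])
  have hvw2 : vstar ≠ w2 := by simp [hdist]
  obtain ⟨hcover, -, -, -, -, hA, hB⟩ := hFII
  by_contra hv
  have hw1 : w1 ∉ F := mt hw1F hv
  -- Two of `vstar`, `w1`, `w2` lie in the same 2-independent set, but all are at distance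
  -- at most 2.
  rcases (hcover w1).resolve_left hw1 with h1 | h1 <;>
    rcases (hcover w2).resolve_left (mt hw2F hw1) with h2 | h2 <;>
    rcases (hcover vstar).resolve_left hv with h0 | h0
  all_goals first
    | exact (hA vstar h0 w1 h1 hvw1.ne).1 hvw1
    | exact (hB vstar h0 w1 h1 hvw1.ne).1 hvw1
    | exact (hA w1 h1 w2 h2 hw1w2.ne).1 hw1w2
    | exact (hB w1 h1 w2 h2 hw1w2.ne).1 hw1w2
    | exact hvw2 (hA.eq_of_adj h0 h2 hvw1.symm hw1w2)
    | exact hvw2 (hB.eq_of_adj h0 h2 hvw1.symm hw1w2)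
end

section
/- Let G be a finite simple graph and let v be a vertex of degree exactly 3 lying on a pendent triangle v v1 v2, i.e., v, v1, v2 are pairwise adjacent and v1 and v2 both have degree exactly 2 in G. If the graph G − {v1, v2} has an FII-partition, then G has an FII-partition. -/
open scoped Classical

namespace SimpleGraph

variable {W : Type*} {G : SimpleGraph W}

/-- Adding a vertex with at most one neighbor in `S` to an induced forest on `S` gives a forest. -/
theorem IsAcyclic.induce_insert {S : Set W} {x : W} (hS : (G.induce S).IsAcyclic)
    (hx : (G.neighborSet x ∩ S).Subsingleton) : (G.induce (insert x S)).IsAcyclic := by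
  intro a c hc
  have hc' : (c.map (Embedding.induce (insert x S)).toHom).IsCycle :=
    hc.map (Embedding.induce (G := G) (insert x S)).injective
  have hsupp : ∀ w ∈ (c.map (Embedding.induce (insert x S)).toHom).support, w ∈ insert x S := by
    intro w hw
    rw [Walk.support_map, List.mem_map] at hw
    obtain ⟨y, -, rfl⟩ := hw
    exact y.2
  generalize c.map (Embedding.induce (insert x S)).toHom = d at hc' hsupp
  by_cases hxd : x ∈ d.support
  · have hr := hc'.rotate hxd
    have hmem : ∀ w ∈ (d.rotate x hxd).support, G.Adj x w → w ∈ G.neighborSet x ∩ S := by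
      intro w hw hadj
      rw [Walk.mem_support_rotate_iff] at hw
      exact ⟨hadj, (hsupp w hw).resolve_left hadj.ne'⟩
    exact hr.snd_ne_penultimate <| hx
      (hmem _ (Walk.getVert_mem_support _ _) ((d.rotate x hxd).adj_snd hr.not_nil))
      (hmem _ (Walk.getVert_mem_support _ _) ((d.rotate x hxd).adj_penultimate hr.not_nil).symm)
  · have hdS : ∀ w ∈ d.support, w ∈ S := fun w hw =>
      (hsupp w hw).resolve_left fun h => hxd (h ▸ hw)
    refine hS (d.induce S hdS) (Walk.IsCycle.of_map (f := (Embedding.induce S).toHom) ?_)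
    rwa [Walk.map_induce]

/-- An induced forest of an induced subgraph is an induced forest of the whole graph. -/
theorem IsAcyclic.induce_image_val {C : Set W} {S : Set C}
    (hS : ((G.induce C).induce S).IsAcyclic) : (G.induce (Subtype.val '' S)).IsAcyclic := by
  have hC : ∀ y ∈ Subtype.val '' S, ∃ h : y ∈ C, (⟨y, h⟩ : C) ∈ S := by
    rintro _ ⟨y, hy, rfl⟩
    exact ⟨y.2, hy⟩
  refine hS.comap ⟨fun y => ⟨⟨y.1, (hC y y.2).1⟩, (hC y y.2).2⟩, fun h => h⟩ ?_
  intro y z h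
  exact Subtype.ext (congrArg (fun t => t.1.1) h)

/-- A finite set of neighbors at least as large as the degree exhausts the neighborhood. -/
theorem mem_of_adj_of_subset_of_degree_le {x : W} [Fintype (G.neighborSet x)] {s : Finset W}
    (hs : ∀ w ∈ s, G.Adj x w) (hcard : G.degree x ≤ s.card) {w : W} (hw : G.Adj x w) : w ∈ s := by
  have : s = G.neighborFinset x :=
    Finset.eq_of_subset_of_card_le (fun w hw => by simpa using hs w hw) (by simpa using hcard)
  simpa [this] using hw

end SimpleGraph

section FII

variable {W : Type*} {G : SimpleGraph W}

/-- A 2-independent set of an induced subgraph is 2-independent in the whole graph if no deleted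
vertex is adjacent to two of its members. -/
theorem TwoIndepSet.image_val {C : Set W} {A : Set C} (hA : TwoIndepSet (G.induce C) A)
    (hC : ∀ w ∉ C, (G.neighborSet w ∩ C).Subsingleton) : TwoIndepSet G (Subtype.val '' A) := by
  rintro _ ⟨a, ha, rfl⟩ _ ⟨b, hb, rfl⟩ hab
  obtain ⟨h, h'⟩ := hA a ha b hb (fun e => hab (e ▸ rfl))
  refine ⟨h, fun w hw => ?_⟩
  by_cases hwC : w ∈ C
  · exact h' ⟨w, hwC⟩ hw
  · exact hab (hC w hwC ⟨hw.1.symm, a.2⟩ ⟨hw.2, b.2⟩)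

theorem TwoIndepSet.insert {A : Set W} {x : W} (hA : TwoIndepSet G A)
    (hx : ∀ a ∈ A, ¬G.Adj x a ∧ ∀ w, ¬(G.Adj x w ∧ G.Adj w a)) :
    TwoIndepSet G (insert x A) := by
  rintro a (rfl | ha) b (rfl | hb) hab
  · exact absurd rfl hab
  · exact hx b hb
  · exact ⟨fun h => (hx a ha).1 h.symm, fun w hw => (hx a ha).2 w ⟨hw.2.symm, hw.1.symm⟩⟩
  · exact hA a ha b hb hab

theorem IsFIIPartition.swap {F A B : Set W} (h : IsFIIPartition G F A B) :
    IsFIIPartition G F B A := by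
  obtain ⟨hcov, hFA, hFB, hAB, hF, hA, hB⟩ := h
  exact ⟨fun v => (hcov v).imp_right Or.symm, hFB, hFA, hAB.symm, hF, hB, hA⟩

end FII

/-- [C4] If `v` is a 3-vertex on a pendent triangle `v v1 v2` and `G − {v1, v2}` has an
FII-partition, then so does `G`. -/
theorem hasFIIPartition_of_three_vertex_pendent_triangle {V : Type*} [Fintype V]
    (G : SimpleGraph V) (v v1 v2 : V)
    (hvv1 : G.Adj v v1) (hvv2 : G.Adj v v2) (hv12 : G.Adj v1 v2)
    (hdv : G.degree v = 3) (hd1 : G.degree v1 = 2) (hd2 : G.degree v2 = 2)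
    (h : HasFIIPartition (G.induce ({v1, v2} : Set V)ᶜ)) :
    HasFIIPartition G := by
  obtain ⟨F, A, B, hP⟩ := h
  have hN1 : ∀ w, G.Adj v1 w → w = v ∨ w = v2 := fun w hw => by
    simpa using SimpleGraph.mem_of_adj_of_subset_of_degree_le (s := {v, v2})
      (by simp [hvv1.symm, hv12]) (by rw [Finset.card_pair hvv2.ne, hd1]) hw
  have hN2 : ∀ w, G.Adj v2 w → w = v ∨ w = v1 := fun w hw => by
    simpa using SimpleGraph.mem_of_adj_of_subset_of_degree_le (s := {v, v1})
      (by simp [hvv2.symm, hv12.symm]) (by rw [Finset.card_pair hvv1.ne, hd2]) hw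
  obtain ⟨u, hN⟩ : ∃ u, ∀ w, G.Adj v w → w = u ∨ w = v1 ∨ w = v2 := by
    obtain ⟨u, hu, hu'⟩ := Finset.exists_mem_notMem_of_card_lt_card
      (s := {v1, v2}) (t := G.neighborFinset v)
      (by rw [Finset.card_pair hv12.ne, G.card_neighborFinset_eq_degree, hdv]; norm_num)
    refine ⟨u, fun w hw => ?_⟩
    simpa using SimpleGraph.mem_of_adj_of_subset_of_degree_le (s := {u, v1, v2})
      (by simpa [hvv1, hvv2] using hu)
      (by rw [Finset.card_insert_of_notMem hu', Finset.card_pair hv12.ne, hdv]) hw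
  have hC : ∀ w ∉ ({v1, v2} : Set V)ᶜ,
      (G.neighborSet w ∩ ({v1, v2} : Set V)ᶜ).Subsingleton := by
    intro w hw a ha b hb
    simp only [Set.mem_compl_iff, Set.mem_insert_iff, Set.mem_singleton_iff, not_not,
      Set.mem_inter_iff, SimpleGraph.mem_neighborSet] at hw ha hb
    grind
  have hne1 : ∀ (S : Set ↥({v1, v2} : Set V)ᶜ), v1 ∉ Subtype.val '' S := by
    rintro S ⟨y, -, hy⟩
    exact y.2 (by simp [hy])
  have hne2 : ∀ (S : Set ↥({v1, v2} : Set V)ᶜ), v2 ∉ Subtype.val '' S := by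
    rintro S ⟨y, -, hy⟩
    exact y.2 (by simp [hy])
  have hcover : ∀ F A B : Set ↥({v1, v2} : Set V)ᶜ, (∀ w, w ∈ F ∨ w ∈ A ∨ w ∈ B) → ∀ w : V,
      w = v1 ∨ w = v2 ∨ w ∈ Subtype.val '' F ∨ w ∈ Subtype.val '' A ∨ w ∈ Subtype.val '' B := by
    intro F A B hcov w
    by_cases hw : w ∈ ({v1, v2} : Set V)ᶜ
    · have := hcov ⟨w, hw⟩
      simp only [Set.mem_image, Subtype.exists, exists_and_right, exists_eq_right]
      grind
    · simp only [Set.mem_compl_iff, Set.mem_insert_iff, Set.mem_singleton_iff, not_not] at hw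
      tauto
  -- If `v` lies in the forest, `v1` can join a 2-independent set avoiding `u`.
  have key : ∀ F A B : Set ↥({v1, v2} : Set V)ᶜ,
      IsFIIPartition (G.induce ({v1, v2} : Set V)ᶜ) F A B →
      u ∉ Subtype.val '' A → v ∈ Subtype.val '' F → HasFIIPartition G := by
    rintro F A B ⟨hcov, hFA, hFB, hAB, hF, hA, hB⟩ huA hvF
    have hFA' := (Set.disjoint_image_iff Subtype.val_injective).2 hFA
    have hFB' := (Set.disjoint_image_iff Subtype.val_injective).2 hFB
    have hAB' := (Set.disjoint_image_iff Subtype.val_injective).2 hAB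
    have hvA := Set.disjoint_left.1 hFA' hvF
    refine ⟨insert v2 (Subtype.val '' F), insert v1 (Subtype.val '' A), Subtype.val '' B,
      fun w => ?_, ?_, ?_, ?_, ?_, ?_, hB.image_val hC⟩
    · have := hcover F A B hcov w
      simp only [Set.mem_insert_iff]
      tauto
    · rw [Set.disjoint_insert_left, Set.disjoint_insert_right, Set.mem_insert_iff, not_or]
      exact ⟨⟨hv12.ne', hne2 A⟩, hne1 F, hFA'⟩
    · exact Set.disjoint_insert_left.2 ⟨hne2 B, hFB'⟩
    · exact Set.disjoint_insert_left.2 ⟨hne1 B, hAB'⟩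
    · refine hF.induce_image_val.induce_insert ?_
      rintro a ⟨ha, haF⟩ b ⟨hb, hbF⟩
      rw [(hN2 a ha).resolve_right fun h => hne1 F (h ▸ haF),
        (hN2 b hb).resolve_right fun h => hne1 F (h ▸ hbF)]
    · refine (hA.image_val hC).insert fun a ha => ⟨fun h => ?_, fun w ⟨hw, hwa⟩ => ?_⟩
      · rcases hN1 a h with rfl | rfl
        exacts [hvA ha, hne2 A ha]
      · have h1 := hne1 A
        have h2 := hne2 A
        rcases hN1 w hw with rfl | rfl
        · rcases hN a hwa with rfl | rfl | rfl <;> contradiction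
        · rcases hN2 a hwa with rfl | rfl <;> contradiction
  by_cases hvF : v ∈ Subtype.val '' F
  · by_cases huA : u ∈ Subtype.val '' A
    · exact key F B A hP.swap (Set.disjoint_left.1
        ((Set.disjoint_image_iff Subtype.val_injective).2 hP.2.2.2.1) huA) hvF
    · exact key F A B hP huA hvF
  · obtain ⟨hcov, hFA, hFB, hAB, hF, hA, hB⟩ := hP
    have hFA' := (Set.disjoint_image_iff Subtype.val_injective).2 hFA
    have hFB' := (Set.disjoint_image_iff Subtype.val_injective).2 hFB
    refine ⟨insert v1 (insert v2 (Subtype.val '' F)), Subtype.val '' A, Subtype.val '' B,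
      fun w => ?_, ?_, ?_, (Set.disjoint_image_iff Subtype.val_injective).2 hAB, ?_,
      hA.image_val hC, hB.image_val hC⟩
    · have := hcover F A B hcov w
      simp only [Set.mem_insert_iff]
      tauto
    · exact Set.disjoint_insert_left.2 ⟨hne1 A, Set.disjoint_insert_left.2 ⟨hne2 A, hFA'⟩⟩
    · exact Set.disjoint_insert_left.2 ⟨hne1 B, Set.disjoint_insert_left.2 ⟨hne2 B, hFB'⟩⟩
    · refine (hF.induce_image_val.induce_insert ?_).induce_insert ?_
      · rintro a ⟨ha, haF⟩
        rcases hN2 a ha with rfl | rfl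
        exacts [absurd haF hvF, absurd haF (hne1 F)]
      · have hv : v ∉ insert v2 (Subtype.val '' F) := by
          rintro (h | h)
          exacts [hvv2.ne h, hvF h]
        rintro a ⟨ha, haF⟩ b ⟨hb, hbF⟩
        rw [(hN1 a ha).resolve_left fun h => hv (h ▸ haF),
          (hN1 b hb).resolve_left fun h => hv (h ▸ hbF)]
end
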